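/- arXiv:cond-mat/0404107 — 2 statements merged into one kernel-verified Lean document; each statement's English description precedes it below -/
import Mathlib

section
/- In the A₂(3) model, assume that for each j = 1, 2: (i) d_j > 0, or d_j = 0 and κ_{3j} < 0; (ii) d_j - κ_{3j}γ - (β_{3j}/2)γ² ≥ 0; (iii) κ_{3j} + β_{3j}γ ≤ 0; (iv) β_{3j} > 0 or κ_{3j} < 0; and in addition d₀ ≥ (α₃/2)γ². Then C is strictly decreasing on [0,∞); moreover, for every x = (x₁,x₂,x₃) with x₁ > 0, x₂ > 0, x₃ > 0, the map τ ↦ P(x,τ) is strictly decreasing on [0,∞), and for every τ > 0 the map x ↦ P(x,τ) is strictly decreasing in each of x₁, x₂, x₃. -/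
open Set MeasureTheory

theorem hasDerivAt_max_zero_sq (x : ℝ) :
    HasDerivAt (fun y : ℝ => max y 0 ^ 2) (2 * max x 0) x := by
  rcases lt_trichotomy x 0 with hx | rfl | hx
  · rw [max_eq_right hx.le, mul_zero]
    refine (hasDerivAt_const x (0 : ℝ)).congr_of_eventuallyEq ?_
    filter_upwards [Iio_mem_nhds hx] with y hy
    rw [max_eq_right (le_of_lt hy)]
    norm_num
  · rw [max_self, mul_zero, hasDerivAt_iff_isLittleO]
    have hsq : (fun y : ℝ => y ^ 2) =o[nhds 0] fun y => y := by
      simpa using Asymptotics.isLittleO_pow_pow (𝕜 := ℝ) (show 1 < 2 by norm_num)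
    have hle : (fun y : ℝ => max y 0 ^ 2) =O[nhds 0] fun y => y ^ 2 := by
      refine Asymptotics.IsBigO.of_bound 1 (Filter.Eventually.of_forall fun y => ?_)
      rw [Real.norm_of_nonneg (sq_nonneg _), Real.norm_of_nonneg (sq_nonneg _), one_mul]
      rcases le_total y 0 with hy | hy
      · rw [max_eq_right hy]
        nlinarith [sq_nonneg y]
      · rw [max_eq_left hy]
    simpa using hle.trans_isLittleO hsq
  · rw [max_eq_left hx.le]
    have h : HasDerivAt (fun y : ℝ => y ^ 2) (2 * x) x := by
      simpa using hasDerivAt_pow 2 x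
    refine h.congr_of_eventuallyEq ?_
    filter_upwards [Ioi_mem_nhds hx] with y hy
    rw [max_eq_left (le_of_lt hy)]

/-- Comparison with zero for a planar cooperative linear system of differential inequalities. -/
theorem nonpos_of_cooperative {u v u' v' a e : ℝ → ℝ} {b c : ℝ} (hb : 0 ≤ b) (hc : 0 ≤ c)
    (hu : ∀ t ∈ Ici (0 : ℝ), HasDerivWithinAt u (u' t) (Ici 0) t)
    (hv : ∀ t ∈ Ici (0 : ℝ), HasDerivWithinAt v (v' t) (Ici 0) t)
    (ha : ContinuousOn a (Ici 0)) (he : ContinuousOn e (Ici 0))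
    (hu' : ∀ t ∈ Ici (0 : ℝ), u' t ≤ a t * u t + b * v t)
    (hv' : ∀ t ∈ Ici (0 : ℝ), v' t ≤ c * u t + e t * v t)
    (hu0 : u 0 ≤ 0) (hv0 : v 0 ≤ 0) {T : ℝ} (hT : 0 ≤ T) : u T ≤ 0 ∧ v T ≤ 0 := by
  have hsub : Icc 0 T ⊆ Ici (0 : ℝ) := Icc_subset_Ici_self
  obtain ⟨Ma, hMa⟩ := isCompact_Icc.bddAbove_image (ha.mono hsub)
  obtain ⟨Me, hMe⟩ := isCompact_Icc.bddAbove_image (he.mono hsub)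
  set M := max Ma Me
  set K := 2 * M + b + c
  let w : ℝ → ℝ := fun t => max (u t) 0 ^ 2 + max (v t) 0 ^ 2
  let w' : ℝ → ℝ := fun t => 2 * max (u t) 0 * u' t + 2 * max (v t) 0 * v' t
  have hw : ∀ t ∈ Ici (0 : ℝ), HasDerivWithinAt w (w' t) (Ici 0) t := fun t ht =>
    ((hasDerivAt_max_zero_sq (u t)).comp_hasDerivWithinAt t (hu t ht)).add
      ((hasDerivAt_max_zero_sq (v t)).comp_hasDerivWithinAt t (hv t ht))
  have hw' : ∀ t ∈ Icc 0 T, w' t ≤ K * w t := by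
    intro t ht
    have hat : a t ≤ M := (hMa (mem_image_of_mem a ht)).trans (le_max_left _ _)
    have het : e t ≤ M := (hMe (mem_image_of_mem e ht)).trans (le_max_right _ _)
    have h1 := hu' t (hsub ht)
    have h2 := hv' t (hsub ht)
    have key : ∀ x : ℝ, max x 0 * x = max x 0 ^ 2 := by
      intro x
      rcases le_total x 0 with hx | hx
      · simp [max_eq_right hx]
      · rw [max_eq_left hx, sq]
    have ku := key (u t)
    have kv := key (v t)
    have lu := le_max_left (u t) 0
    have lv := le_max_left (v t) 0
    have pu := le_max_right (u t) 0
    have pv := le_max_right (v t) 0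
    simp only [w, w', K]
    generalize max (u t) 0 = p at *
    generalize max (v t) 0 = q at *
    have hp : p * u' t ≤ M * p ^ 2 + b * (p * q) := calc
      p * u' t ≤ p * (a t * u t + b * v t) := mul_le_mul_of_nonneg_left h1 pu
      _ = a t * p ^ 2 + b * (p * v t) := by rw [← ku]; ring
      _ ≤ _ := by gcongr
    have hq : q * v' t ≤ M * q ^ 2 + c * (p * q) := calc
      q * v' t ≤ q * (c * u t + e t * v t) := mul_le_mul_of_nonneg_left h2 pv
      _ = e t * q ^ 2 + c * (u t * q) := by rw [← kv]; ring
      _ ≤ _ := by gcongr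
    nlinarith [mul_nonneg (add_nonneg hb hc) (sq_nonneg (p - q))]
  have hexp : ∀ t : ℝ, HasDerivAt (fun t => Real.exp (-(K * t))) (Real.exp (-(K * t)) * -K) t :=
    fun t => by simpa using ((hasDerivAt_id t).const_mul K).neg.exp
  have hanti : AntitoneOn (fun t => w t * Real.exp (-(K * t))) (Icc 0 T) := by
    refine antitoneOn_of_hasDerivWithinAt_nonpos (convex_Icc 0 T)
      (f' := fun t => w' t * Real.exp (-(K * t)) + w t * (Real.exp (-(K * t)) * -K)) ?_ ?_ ?_
    · exact fun t ht =>
        (((hw t (hsub ht)).mul (hexp t).hasDerivWithinAt).continuousWithinAt).mono hsub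
    · intro t ht
      rw [interior_Icc] at ht ⊢
      exact ((hw t ht.1.le).mul (hexp t).hasDerivWithinAt).mono fun s hs => hs.1.le
    · intro t ht
      have ht' := hw' t (interior_subset ht)
      nlinarith [Real.exp_pos (-(K * t))]
  have h0 : w 0 = 0 := by simp [w, max_eq_right hu0, max_eq_right hv0]
  have hwT : w T ≤ 0 := by
    have h := hanti (left_mem_Icc.2 hT) (right_mem_Icc.2 hT) hT
    simp only [h0, zero_mul] at h
    exact nonpos_of_mul_nonpos_left h (Real.exp_pos _)
  have pu := sq_nonneg (max (u T) 0)
  have pv := sq_nonneg (max (v T) 0)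
  have hsum : max (u T) 0 ^ 2 + max (v T) 0 ^ 2 ≤ 0 := hwT
  constructor
  · have : max (u T) 0 = 0 := pow_eq_zero_iff two_ne_zero |>.1 (by linarith)
    exact max_eq_right_iff.1 this
  · have : max (v T) 0 = 0 := pow_eq_zero_iff two_ne_zero |>.1 (by linarith)
    exact max_eq_right_iff.1 this

theorem HasDerivWithinAt.comp_add_const_Ici {f : ℝ → ℝ} {f' h t : ℝ} (hh : 0 ≤ h)
    (hf : HasDerivWithinAt f f' (Ici 0) (t + h)) :
    HasDerivWithinAt (fun s => f (s + h)) f' (Ici 0) t := by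
  have hshift : HasDerivWithinAt (fun s : ℝ => s + h) 1 (Ici 0) t :=
    ((hasDerivAt_id t).add_const h).hasDerivWithinAt
  simpa [Function.comp_def] using
    hf.comp t hshift (fun s hs => add_nonneg (mem_Ici.1 hs) hh)

/-- A planar cooperative Riccati system started at the origin, with nonpositive nonincreasing
forcing, has nonpositive nonincreasing components. -/
theorem cooperative_riccati_nonpos_antitoneOn {u v g k : ℝ → ℝ} {p q b c r s : ℝ}
    (hb : 0 ≤ b) (hc : 0 ≤ c)
    (hu : ∀ t ∈ Ici (0 : ℝ),
      HasDerivWithinAt u (p * u t + b * v t + r * u t ^ 2 + g t) (Ici 0) t)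
    (hv : ∀ t ∈ Ici (0 : ℝ),
      HasDerivWithinAt v (c * u t + q * v t + s * v t ^ 2 + k t) (Ici 0) t)
    (hu0 : u 0 = 0) (hv0 : v 0 = 0)
    (hg : ∀ t ∈ Ici (0 : ℝ), g t ≤ 0) (hk : ∀ t ∈ Ici (0 : ℝ), k t ≤ 0)
    (hg' : AntitoneOn g (Ici 0)) (hk' : AntitoneOn k (Ici 0)) :
    (∀ t ∈ Ici (0 : ℝ), u t ≤ 0 ∧ v t ≤ 0) ∧ AntitoneOn u (Ici 0) ∧ AntitoneOn v (Ici 0) := by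
  have cu : ContinuousOn u (Ici 0) := fun t ht => (hu t ht).continuousWithinAt
  have cv : ContinuousOn v (Ici 0) := fun t ht => (hv t ht).continuousWithinAt
  have hneg : ∀ t ∈ Ici (0 : ℝ), u t ≤ 0 ∧ v t ≤ 0 := by
    intro t ht
    refine nonpos_of_cooperative (a := fun t => p + r * u t) (e := fun t => q + s * v t)
      hb hc hu hv (by fun_prop) (by fun_prop) ?_ ?_ hu0.le hv0.le ht
    · intro t ht
      linarith [hg t ht]
    · intro t ht
      linarith [hk t ht]
  have hshift : ∀ h ∈ Ici (0 : ℝ), ∀ t ∈ Ici (0 : ℝ),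
      u (t + h) - u t ≤ 0 ∧ v (t + h) - v t ≤ 0 := by
    intro h hh t ht
    have hmaps : MapsTo (fun t : ℝ => t + h) (Ici 0) (Ici 0) := fun t ht =>
      add_nonneg (mem_Ici.1 ht) hh
    have hadd : ContinuousOn (fun t : ℝ => t + h) (Ici 0) := by fun_prop
    have cuh : ContinuousOn (fun t => u (t + h)) (Ici 0) := cu.comp hadd hmaps
    have cvh : ContinuousOn (fun t => v (t + h)) (Ici 0) := cv.comp hadd hmaps
    refine nonpos_of_cooperative (u := fun t => u (t + h) - u t) (v := fun t => v (t + h) - v t)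
      (a := fun t => p + r * (u (t + h) + u t)) (e := fun t => q + s * (v (t + h) + v t))
      hb hc
      (fun t ht => ((hu (t + h) (hmaps ht)).comp_add_const_Ici hh).sub (hu t ht))
      (fun t ht => ((hv (t + h) (hmaps ht)).comp_add_const_Ici hh).sub (hv t ht))
      (by fun_prop) (by fun_prop) ?_ ?_ ?_ ?_ ht
    · intro t ht
      linarith [hg' ht (hmaps ht) (le_add_of_nonneg_right hh)]
    · intro t ht
      linarith [hk' ht (hmaps ht) (le_add_of_nonneg_right hh)]
    · simpa [hu0] using (hneg h hh).1
    · simpa [hv0] using (hneg h hh).2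
  refine ⟨hneg, fun x hx y _ hxy => ?_, fun x hx y _ hxy => ?_⟩
  · have := (hshift (y - x) (sub_nonneg.2 hxy) x hx).1
    rw [add_sub_cancel] at this
    linarith
  · have := (hshift (y - x) (sub_nonneg.2 hxy) x hx).2
    rw [add_sub_cancel] at this
    linarith

theorem AntitoneOn.neg_of_hasDerivWithinAt_neg {f f' : ℝ → ℝ} (hf : AntitoneOn f (Ici 0))
    (hf0 : f 0 = 0) (hd : ∀ t ∈ Ici (0 : ℝ), HasDerivWithinAt f (f' t) (Ici 0) t)
    (hf' : ∀ t, 0 < t → f t = 0 → f' t < 0) {t : ℝ} (ht : 0 < t) : f t < 0 := by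
  by_contra! hcon
  have hzero : ∀ s ∈ Icc 0 t, f s = 0 := fun s hs =>
    le_antisymm (hf0 ▸ hf self_mem_Ici hs.1 hs.1)
      (hcon.trans (hf hs.1 ht.le hs.2))
  have hmem : t / 2 ∈ Ioo 0 t := ⟨by linarith, by linarith⟩
  have h1 : HasDerivAt f (f' (t / 2)) (t / 2) :=
    (hd _ hmem.1.le).hasDerivAt (Ici_mem_nhds hmem.1)
  have h2 : HasDerivAt f 0 (t / 2) := by
    refine (hasDerivAt_const (t / 2) (0 : ℝ)).congr_of_eventuallyEq ?_
    filter_upwards [Ioo_mem_nhds hmem.1 hmem.2] with s hs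
    exact hzero s (Ioo_subset_Icc_self hs)
  have := hf' _ hmem.1 (hzero _ (Ioo_subset_Icc_self hmem))
  rw [h1.unique h2] at this
  exact lt_irrefl _ this

theorem quadratic_antitone_of_slope_nonpos {κ β γ d x y : ℝ} (hβ : 0 ≤ β) (hslope : κ + β * γ ≤ 0)
    (hy : -γ ≤ y) (hyx : y ≤ x) :
    -d - κ * y + β / 2 * y ^ 2 ≤ -d - κ * x + β / 2 * x ^ 2 := by
  have h : κ - β / 2 * (x + y) ≤ 0 := by nlinarith
  nlinarith [mul_nonneg (sub_nonneg.2 hyx) (neg_nonneg.2 h)]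

theorem quadratic_neg_of_slope_nonpos {κ β γ d y : ℝ} (hβ : 0 ≤ β) (hd : 0 ≤ d)
    (hslope : κ + β * γ ≤ 0) (hpos : 0 < β ∨ κ < 0) (hy : -γ < y) (hy0 : y < 0) :
    -d - κ * y + β / 2 * y ^ 2 < 0 := by
  have h : κ - β / 2 * y < 0 := by
    rcases hpos with h | h
    · nlinarith
    · rcases hβ.eq_or_lt with rfl | hβ
      · linarith
      · nlinarith
  nlinarith [mul_pos (neg_pos.2 hy0) (neg_pos.2 h)]


/-- **A₂(3) model, monotonicity of `C` and of the bond price.**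
Under the sufficient conditions of Theorem 3.7 and `d₀ ≥ (α₃/2)γ²`, the function `C`
is strictly decreasing on `[0,∞)`; for every `x` with positive coordinates the bond
price `τ ↦ P x τ` is strictly decreasing on `[0,∞)`, and for every `τ > 0` the bond
price is strictly decreasing in each of `x₁`, `x₂`, `x₃` on the positive orthant. -/
theorem stmt_15 (θ₁ θ₂ κ₁₁ κ₂₂ κ₃₃ κ₂₁ κ₁₂ κ₃₁ κ₃₂ α₃ β₁₁ β₂₂ β₃₁ β₃₂ d₀ d₁ d₂ d₃ γ : ℝ)
    (hθ₁ : 0 < θ₁) (hθ₂ : 0 < θ₂)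
    (hκ₁₁ : 0 < κ₁₁) (hκ₂₂ : 0 < κ₂₂) (hκ₃₃ : 0 < κ₃₃)
    (hκ₂₁ : κ₂₁ ≤ 0) (hκ₁₂ : κ₁₂ ≤ 0) (hΔpos : 0 < κ₁₁ * κ₂₂ - κ₁₂ * κ₂₁)
    (hα₃ : 0 < α₃) (hβ₁₁ : 0 < β₁₁) (hβ₂₂ : 0 < β₂₂)
    (hβ₃₁ : 0 ≤ β₃₁) (hβ₃₂ : 0 ≤ β₃₂)
    (hd₁ : 0 ≤ d₁) (hd₂ : 0 ≤ d₂) (hd₃ : 0 < d₃) (hγ : γ = d₃ / κ₃₃)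
    (B₃ : ℝ → ℝ) (hB₃ : ∀ τ, B₃ τ = -γ * (1 - Real.exp (-(κ₃₃ * τ))))
    (B₁ B₂ : ℝ → ℝ) (hB₁0 : B₁ 0 = 0) (hB₂0 : B₂ 0 = 0)
    (hB₁ : ∀ τ ∈ Set.Ici (0:ℝ),
      HasDerivWithinAt B₁
        (-(κ₁₁ * B₁ τ) - κ₂₁ * B₂ τ + (β₁₁ / 2) * B₁ τ ^ 2 - d₁
          - κ₃₁ * B₃ τ + (β₃₁ / 2) * B₃ τ ^ 2) (Set.Ici 0) τ)
    (hB₂ : ∀ τ ∈ Set.Ici (0:ℝ),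
      HasDerivWithinAt B₂
        (-(κ₁₂ * B₁ τ) - κ₂₂ * B₂ τ + (β₂₂ / 2) * B₂ τ ^ 2 - d₂
          - κ₃₂ * B₃ τ + (β₃₂ / 2) * B₃ τ ^ 2) (Set.Ici 0) τ)
    (C : ℝ → ℝ)
    (hC : ∀ τ, C τ = ∫ s in (0:ℝ)..τ,
      (-d₀ + θ₁ * B₁ s + θ₂ * B₂ s + (α₃ / 2) * B₃ s ^ 2))
    (P : ℝ → ℝ → ℝ → ℝ → ℝ)
    (hP : ∀ x₁ x₂ x₃ τ,
      P x₁ x₂ x₃ τ = Real.exp (B₁ τ * x₁ + B₂ τ * x₂ + B₃ τ * x₃ + C τ))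
    (h11 : 0 < d₁ ∨ (d₁ = 0 ∧ κ₃₁ < 0)) (h12 : 0 < d₂ ∨ (d₂ = 0 ∧ κ₃₂ < 0))
    (h21 : 0 ≤ d₁ - κ₃₁ * γ - (β₃₁ / 2) * γ ^ 2)
    (h22 : 0 ≤ d₂ - κ₃₂ * γ - (β₃₂ / 2) * γ ^ 2)
    (h31 : κ₃₁ + β₃₁ * γ ≤ 0) (h32 : κ₃₂ + β₃₂ * γ ≤ 0)
    (h41 : 0 < β₃₁ ∨ κ₃₁ < 0) (h42 : 0 < β₃₂ ∨ κ₃₂ < 0)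
    (hd₀ : (α₃ / 2) * γ ^ 2 ≤ d₀) :
    StrictAntiOn C (Set.Ici 0) ∧
    (∀ x₁ x₂ x₃ : ℝ, 0 < x₁ → 0 < x₂ → 0 < x₃ →
      StrictAntiOn (fun τ => P x₁ x₂ x₃ τ) (Set.Ici 0)) ∧
    (∀ τ : ℝ, 0 < τ →
      (∀ x₂ x₃ : ℝ, 0 < x₂ → 0 < x₃ →
        StrictAntiOn (fun x₁ => P x₁ x₂ x₃ τ) (Set.Ioi 0)) ∧
      (∀ x₁ x₃ : ℝ, 0 < x₁ → 0 < x₃ →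
        StrictAntiOn (fun x₂ => P x₁ x₂ x₃ τ) (Set.Ioi 0)) ∧
      (∀ x₁ x₂ : ℝ, 0 < x₁ → 0 < x₂ →
        StrictAntiOn (fun x₃ => P x₁ x₂ x₃ τ) (Set.Ioi 0))) := by
  have hγpos : 0 < γ := hγ ▸ div_pos hd₃ hκ₃₃
  have hB₃anti : StrictAnti B₃ := by
    intro x y hxy
    rw [hB₃, hB₃]
    have : Real.exp (-(κ₃₃ * y)) < Real.exp (-(κ₃₃ * x)) :=
      Real.exp_lt_exp.2 (neg_lt_neg (mul_lt_mul_of_pos_left hxy hκ₃₃))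
    nlinarith
  have hB₃0 : B₃ 0 = 0 := by simp [hB₃]
  have hB₃gt : ∀ τ, -γ < B₃ τ := by
    intro τ
    rw [hB₃]
    nlinarith [mul_pos hγpos (Real.exp_pos (-(κ₃₃ * τ)))]
  have hB₃neg : ∀ τ, 0 < τ → B₃ τ < 0 := fun τ hτ => hB₃0 ▸ hB₃anti hτ
  have hB₃nonpos : ∀ τ ∈ Ici (0 : ℝ), B₃ τ ≤ 0 := fun τ hτ => hB₃0 ▸ hB₃anti.antitone hτ
  have hB₃cont : Continuous B₃ := by
    rw [funext hB₃]
    fun_prop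
  have hforce : ∀ {κ β d : ℝ}, 0 ≤ β → 0 ≤ d → κ + β * γ ≤ 0 →
      (∀ t ∈ Ici (0 : ℝ), -d - κ * B₃ t + β / 2 * B₃ t ^ 2 ≤ 0) ∧
      AntitoneOn (fun t => -d - κ * B₃ t + β / 2 * B₃ t ^ 2) (Ici 0) := by
    intro κ β d hβ hd hs
    refine ⟨fun t ht => ?_, fun x _ y _ hxy => ?_⟩
    · have := quadratic_antitone_of_slope_nonpos (d := d) hβ hs (hB₃gt t).le (hB₃nonpos t ht)
      linarith
    · exact quadratic_antitone_of_slope_nonpos hβ hs (hB₃gt y).le (hB₃anti.antitone hxy)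
  obtain ⟨hg, hg'⟩ := hforce hβ₃₁ hd₁ h31
  obtain ⟨hk, hk'⟩ := hforce hβ₃₂ hd₂ h32
  obtain ⟨hneg, hB₁anti, hB₂anti⟩ := cooperative_riccati_nonpos_antitoneOn
    (p := -κ₁₁) (q := -κ₂₂) (r := β₁₁ / 2) (s := β₂₂ / 2)
    (neg_nonneg.2 hκ₂₁) (neg_nonneg.2 hκ₁₂)
    (fun t ht => (hB₁ t ht).congr_deriv (by ring))
    (fun t ht => (hB₂ t ht).congr_deriv (by ring)) hB₁0 hB₂0 hg hk hg' hk'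
  have hB₁neg : ∀ τ, 0 < τ → B₁ τ < 0 := fun τ hτ =>
    hB₁anti.neg_of_hasDerivWithinAt_neg hB₁0 hB₁ (fun t ht hzero => by
      have := quadratic_neg_of_slope_nonpos hβ₃₁ hd₁ h31 h41 (hB₃gt t) (hB₃neg t ht)
      rw [hzero]
      nlinarith [mul_nonneg_of_nonpos_of_nonpos hκ₂₁ (hneg t ht.le).2]) hτ
  have hB₂neg : ∀ τ, 0 < τ → B₂ τ < 0 := fun τ hτ =>
    hB₂anti.neg_of_hasDerivWithinAt_neg hB₂0 hB₂ (fun t ht hzero => by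
      have := quadratic_neg_of_slope_nonpos hβ₃₂ hd₂ h32 h42 (hB₃gt t) (hB₃neg t ht)
      rw [hzero]
      nlinarith [mul_nonneg_of_nonpos_of_nonpos hκ₁₂ (hneg t ht.le).1]) hτ
  have hCanti : StrictAntiOn C (Ici 0) := by
    let f : ℝ → ℝ := fun s => -d₀ + θ₁ * B₁ s + θ₂ * B₂ s + (α₃ / 2) * B₃ s ^ 2
    have cB₁ : ContinuousOn B₁ (Ici 0) := fun t ht => (hB₁ t ht).continuousWithinAt
    have cB₂ : ContinuousOn B₂ (Ici 0) := fun t ht => (hB₂ t ht).continuousWithinAt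
    have hf : ContinuousOn f (Ici 0) := by fun_prop
    have hint : ∀ a ∈ Ici (0 : ℝ), ∀ b ∈ Ici (0 : ℝ), IntervalIntegrable f volume a b :=
      fun a ha b hb => (hf.mono (ordConnected_Ici.uIcc_subset ha hb)).intervalIntegrable
    intro x hx y hy hxy
    have hpos : 0 < ∫ s in x..y, -f s := by
      refine intervalIntegral.intervalIntegral_pos_of_pos_on (hint x hx y hy).neg ?_ hxy
      intro s hs
      have hs0 : s ∈ Ici (0 : ℝ) := (mem_Ici.1 hx).trans hs.1.le
      have h1 := mul_nonneg hθ₁.le (neg_nonneg.2 (hneg s hs0).1)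
      have h2 := mul_nonneg hθ₂.le (neg_nonneg.2 (hneg s hs0).2)
      have h3 : B₃ s ^ 2 < γ ^ 2 := by nlinarith [hB₃gt s, hB₃nonpos s hs0]
      have h4 := mul_lt_mul_of_pos_left h3 (half_pos hα₃)
      simp only [f]
      linarith
    rw [intervalIntegral.integral_neg, ← intervalIntegral.integral_interval_sub_left
      (hint 0 self_mem_Ici y hy) (hint 0 self_mem_Ici x hx)] at hpos
    rw [hC, hC]
    linarith
  simp only [hP]
  refine ⟨hCanti, fun x₁ x₂ x₃ hx₁ hx₂ hx₃ s hs t ht hst => ?_, fun τ hτ => ⟨?_, ?_, ?_⟩⟩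
  · refine Real.exp_lt_exp.2 ?_
    have h1 := mul_le_mul_of_nonneg_right (hB₁anti hs ht hst.le) hx₁.le
    have h2 := mul_le_mul_of_nonneg_right (hB₂anti hs ht hst.le) hx₂.le
    have h3 := mul_le_mul_of_nonneg_right (hB₃anti hst).le hx₃.le
    linarith [hCanti hs ht hst]
  · intro x₂ x₃ _ _ x _ y _ hxy
    refine Real.exp_lt_exp.2 ?_
    linarith [mul_lt_mul_of_neg_left hxy (hB₁neg τ hτ)]
  · intro x₁ x₃ _ _ x _ y _ hxy
    refine Real.exp_lt_exp.2 ?_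
    linarith [mul_lt_mul_of_neg_left hxy (hB₂neg τ hτ)]
  · intro x₁ x₂ _ _ x _ y _ hxy
    refine Real.exp_lt_exp.2 ?_
    linarith [mul_lt_mul_of_neg_left hxy (hB₃neg τ hτ)]
end

section
/- Assume d₁ + κ₁₁²/2 - κ₂₁γ - (β/2)γ² > 0. Then there exist γ₊ > 0 and γ₋ < -γ such that for every nondecreasing C^∞ function χ : ℝ → ℝ with χ(y) = γ₋ for all y ≤ -1 and χ(y) = γ₊ for all y ≥ 0, there exist ε₀ ∈ (0,1), C₀ > 0, C₁ > 0 and M₀ > 0 such that for all ε ∈ (0,ε₀) and all (x₁,x₂) with x₁ ≥ 0 and x₂ ∈ ℝ: C₀(x₁ + |x₂|) - M₀/ε ≤ r_ε(x₁,x₂) ≤ C₁(x₁ + |x₂|) + M₀/ε. -/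
/-- The conjugated short rate `r_ε` of the `A₁(2)` model:
`r_ε(x₁,x₂) = d₀ - θ₁κ₁₁ - (α/2)(εχ'(εx₂) + χ(εx₂)²)
  + [d₁ + κ₁₁²/2 + κ₂₁χ(εx₂) - (β/2)(εχ'(εx₂) + χ(εx₂)²)]x₁ + [d₂ + κ₂₂χ(εx₂)]x₂`. -/
noncomputable def rEps (κ₁₁ κ₂₂ θ₁ α β κ₂₁ d₀ d₁ d₂ : ℝ) (χ : ℝ → ℝ)
    (ε x₁ x₂ : ℝ) : ℝ :=
  d₀ - θ₁ * κ₁₁ - (α / 2) * (ε * deriv χ (ε * x₂) + χ (ε * x₂) ^ 2)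
    + (d₁ + κ₁₁ ^ 2 / 2 + κ₂₁ * χ (ε * x₂)
        - (β / 2) * (ε * deriv χ (ε * x₂) + χ (ε * x₂) ^ 2)) * x₁
    + (d₂ + κ₂₂ * χ (ε * x₂)) * x₂

/-- A smooth function that is constant to the left of `-1` and to the right of `0` has a bounded
derivative. -/
lemma exists_bound_deriv_of_eventually_const {χ : ℝ → ℝ} {a b : ℝ}
    (hχ : ContDiff ℝ (⊤ : ℕ∞) χ) (hl : ∀ y ≤ (-1 : ℝ), χ y = a) (hr : ∀ y ≥ (0 : ℝ), χ y = b) :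
    ∃ D > (0 : ℝ), ∀ y, |deriv χ y| ≤ D := by
  have hc : Continuous (deriv χ) := hχ.continuous_deriv (by simp)
  obtain ⟨D, hD⟩ := (isCompact_Icc (a := (-1 : ℝ)) (b := 0)).exists_bound_of_continuousOn
    hc.continuousOn
  refine ⟨|D| + 1, by positivity, fun y => ?_⟩
  rcases lt_or_ge y (-1) with hy | hy
  · have : χ =ᶠ[nhds y] fun _ => a := by
      filter_upwards [Iio_mem_nhds hy] with z hz using hl z (le_of_lt hz)
    rw [this.deriv_eq, deriv_const, abs_zero]
    positivity
  rcases lt_or_ge 0 y with hy' | hy'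
  · have : χ =ᶠ[nhds y] fun _ => b := by
      filter_upwards [Ioi_mem_nhds hy'] with z hz using hr z (le_of_lt hz)
    rw [this.deriv_eq, deriv_const, abs_zero]
    positivity
  · have h := hD y ⟨hy, hy'⟩
    rw [Real.norm_eq_abs] at h
    linarith [le_abs_self D]

/-- A concave quadratic that exceeds `m` at the endpoints of an interval exceeds `m` on it. -/
lemma le_quadratic_of_mem_Icc {A k β m a b v : ℝ} (hβ : 0 ≤ β) (hab : a < b)
    (hav : a ≤ v) (hvb : v ≤ b) (ha : m ≤ A + k * a - β / 2 * a ^ 2)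
    (hb : m ≤ A + k * b - β / 2 * b ^ 2) : m ≤ A + k * v - β / 2 * v ^ 2 := by
  have h1 := mul_le_mul_of_nonneg_right ha (sub_nonneg.2 hvb)
  have h2 := mul_le_mul_of_nonneg_right hb (sub_nonneg.2 hav)
  have h3 : 0 ≤ β / 2 * ((b - a) * ((v - a) * (b - v))) :=
    mul_nonneg (by linarith) (mul_nonneg (by linarith)
      (mul_nonneg (by linarith) (by linarith)))
  refine le_of_mul_le_mul_right ?_ (sub_pos.2 hab)
  linear_combination h1 + h2 + h3

/-- Both endpoints of an interval where a quadratic is positive can be pushed outwards. -/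
lemma exists_pos_quadratic_endpoints {A k β γ : ℝ} (h₀ : 0 < A)
    (hγ : 0 < A - k * γ - β / 2 * γ ^ 2) :
    ∃ η > (0 : ℝ), 0 < A + k * (-γ - η) - β / 2 * (-γ - η) ^ 2 ∧
      0 < A + k * η - β / 2 * η ^ 2 := by
  have hc1 : Continuous fun η : ℝ => A + k * (-γ - η) - β / 2 * (-γ - η) ^ 2 := by fun_prop
  have hc2 : Continuous fun η : ℝ => A + k * η - β / 2 * η ^ 2 := by fun_prop
  have e1 := (hc1.tendsto 0).eventually_const_lt (u := 0) (by linarith)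
  have e2 := (hc2.tendsto 0).eventually_const_lt (u := 0) (by linarith)
  obtain ⟨δ, hδ, h⟩ := Metric.eventually_nhds_iff.1 (e1.and e2)
  refine ⟨δ / 2, half_pos hδ, h ?_⟩
  rw [Real.dist_eq, sub_zero, abs_of_pos (half_pos hδ)]
  linarith

/-- **Two-sided linear bounds for the conjugated short rate.**
If `d₁ + κ₁₁²/2 - κ₂₁γ - (β/2)γ² > 0`, then there exist `γ₊ > 0` and `γ₋ < -γ` such
that for every nondecreasing `C^∞` function `χ` with `χ ≡ γ₋` on `(-∞,-1]` and
`χ ≡ γ₊` on `[0,∞)`, there are `ε₀ ∈ (0,1)`, `C₀, C₁, M₀ > 0` with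
`C₀(x₁+|x₂|) - M₀/ε ≤ r_ε(x₁,x₂) ≤ C₁(x₁+|x₂|) + M₀/ε`
for all `ε ∈ (0,ε₀)`, `x₁ ≥ 0`, `x₂ ∈ ℝ`. -/
theorem stmt_19 (κ₁₁ κ₂₂ θ₁ α β κ₂₁ d₀ d₁ d₂ γ : ℝ)
    (hκ₁₁ : 0 < κ₁₁) (hκ₂₂ : 0 < κ₂₂) (hθ₁ : 0 < θ₁) (hα : 0 < α) (hβ : 0 < β)
    (hd₁ : 0 ≤ d₁) (hd₂ : 0 < d₂) (hγ : γ = d₂ / κ₂₂)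
    (hmain : 0 < d₁ + κ₁₁ ^ 2 / 2 - κ₂₁ * γ - (β / 2) * γ ^ 2) :
    ∃ γp > (0:ℝ), ∃ γm < -γ,
      ∀ χ : ℝ → ℝ, Monotone χ → ContDiff ℝ (⊤ : ℕ∞) χ →
        (∀ y ≤ (-1:ℝ), χ y = γm) → (∀ y ≥ (0:ℝ), χ y = γp) →
        ∃ ε₀ ∈ Set.Ioo (0:ℝ) 1, ∃ C₀ > (0:ℝ), ∃ C₁ > (0:ℝ), ∃ M₀ > (0:ℝ),
          ∀ ε ∈ Set.Ioo (0:ℝ) ε₀, ∀ x₁ ≥ (0:ℝ), ∀ x₂ : ℝ,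
            C₀ * (x₁ + |x₂|) - M₀ / ε ≤ rEps κ₁₁ κ₂₂ θ₁ α β κ₂₁ d₀ d₁ d₂ χ ε x₁ x₂ ∧
            rEps κ₁₁ κ₂₂ θ₁ α β κ₂₁ d₀ d₁ d₂ χ ε x₁ x₂ ≤ C₁ * (x₁ + |x₂|) + M₀ / ε := by
  have hγ0 : 0 < γ := hγ ▸ div_pos hd₂ hκ₂₂
  have hd₂' : d₂ = κ₂₂ * γ := by rw [hγ]; field_simp
  set A := d₁ + κ₁₁ ^ 2 / 2 with hA
  have hA0 : 0 < A := by positivity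
  obtain ⟨η, hη, hqm, hqp⟩ := exists_pos_quadratic_endpoints hA0 hmain
  refine ⟨η, hη, -γ - η, by linarith, fun χ hmono hsm hl hr => ?_⟩
  obtain ⟨D, hD, hDχ⟩ := exists_bound_deriv_of_eventually_const hsm hl hr
  obtain ⟨m, hm, hm1, hm2⟩ : ∃ m > (0 : ℝ), m ≤ A + κ₂₁ * (-γ - η) - β / 2 * (-γ - η) ^ 2 ∧
      m ≤ A + κ₂₁ * η - β / 2 * η ^ 2 :=
    ⟨_, lt_min hqm hqp, min_le_left _ _, min_le_right _ _⟩
  have hlow : ∀ y, -γ - η ≤ χ y := fun y => by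
    rw [← hl (min y (-1)) (min_le_right _ _)]
    exact hmono (min_le_left _ _)
  have hup : ∀ y, χ y ≤ η := fun y => by
    rw [← hr (max y 0) (le_max_right _ _)]
    exact hmono (le_max_left _ _)
  set K := γ + η with hK
  have hK0 : 0 < K := by positivity
  have hq : ∀ y, m ≤ A + κ₂₁ * χ y - β / 2 * χ y ^ 2 := fun y =>
    le_quadratic_of_mem_Icc hβ.le (by linarith) (hlow y) (hup y) hm1 hm2
  have hχK : ∀ y, |χ y| ≤ K := fun y =>
    abs_le.2 ⟨by linarith [hlow y], by linarith [hup y]⟩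
  set M₁ := |d₀ - θ₁ * κ₁₁| + α / 2 * (D + K ^ 2) with hM₁
  have hM₁0 : 0 < M₁ := by positivity
  set B := κ₂₂ * K with hB
  have hB0 : 0 < B := by positivity
  refine ⟨min (1 / 2) (m / (β * D)), ⟨by positivity, by
    linarith [min_le_left (1 / 2) (m / (β * D))]⟩,
    min (m / 2) (κ₂₂ * η), by positivity, A + |κ₂₁| * K + B, by positivity,
    M₁ + 2 * B, by positivity, ?_⟩
  rintro ε ⟨hε, hε'⟩ x₁ hx₁ x₂
  have hε1 : ε < 1 := by linarith [min_le_left (1 / 2) (m / (β * D))]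
  have hεm : ε * (β * D) ≤ m :=
    (le_div_iff₀ (by positivity)).1 (hε'.le.trans (min_le_right _ _))
  unfold rEps
  rw [← hA]
  have hv1 := hq (ε * x₂)
  have hvl := hlow (ε * x₂)
  have hvu := hup (ε * x₂)
  have hvK := hχK (ε * x₂)
  have hp0 : 0 ≤ deriv χ (ε * x₂) := hmono.deriv_nonneg
  have hpD : deriv χ (ε * x₂) ≤ D := (le_abs_self _).trans (hDχ _)
  have hx₂term : κ₂₂ * η * |x₂| - 2 * B / ε ≤ (d₂ + κ₂₂ * χ (ε * x₂)) * x₂ ∧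
      (d₂ + κ₂₂ * χ (ε * x₂)) * x₂ ≤ B * |x₂| := by
    have hBε : 0 ≤ 2 * B / ε := by positivity
    rcases le_or_gt 0 x₂ with h0 | h0
    · rw [hr _ (mul_nonneg hε.le h0), abs_of_nonneg h0]
      have h1 : (d₂ + κ₂₂ * η) * x₂ = B * x₂ := by rw [hB, hK, hd₂']; ring
      have h2 : 0 ≤ κ₂₂ * γ * x₂ := by positivity
      have h3 : B * x₂ = κ₂₂ * γ * x₂ + κ₂₂ * η * x₂ := by rw [hB, hK]; ring
      constructor <;> linarith
    · rw [abs_of_neg h0]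
      have hηB : κ₂₂ * η ≤ B := by
        rw [hB]; exact mul_le_mul_of_nonneg_left (by linarith) hκ₂₂.le
      have hcoef : -(κ₂₂ * η) ≤ d₂ + κ₂₂ * χ (ε * x₂) := by
        have := mul_le_mul_of_nonneg_left hvl hκ₂₂.le
        rw [hd₂']; linarith
      have hcoef' : d₂ + κ₂₂ * χ (ε * x₂) ≤ B := by
        have := mul_le_mul_of_nonneg_left hvu hκ₂₂.le
        rw [hd₂', hB, hK]; linarith
      have hupper := mul_le_mul_of_nonneg_right hcoef (neg_nonneg.2 h0.le)
      have hηx := mul_le_mul_of_nonneg_right hηB (neg_nonneg.2 h0.le)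
      refine ⟨?_, by linarith⟩
      rcases le_or_gt (ε * x₂) (-1) with h1 | h1
      · have : (d₂ + κ₂₂ * χ (ε * x₂)) * x₂ = κ₂₂ * η * -x₂ := by
          rw [hl _ h1, hd₂']; ring
        linarith
      · have hx : -x₂ ≤ 1 / ε := by
          rw [le_div_iff₀ hε]; linarith
        have h2 := mul_le_mul_of_nonneg_left hx hB0.le
        have h3 := mul_le_mul_of_nonneg_right hcoef' (neg_nonneg.2 h0.le)
        have h4 : 2 * B / ε = B * (1 / ε) + B * (1 / ε) := by ring
        linarith
  generalize χ (ε * x₂) = v at *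
  generalize deriv χ (ε * x₂) = p at *
  have hεp : 0 ≤ ε * p := mul_nonneg hε.le hp0
  have hεpD : ε * p ≤ ε * D := mul_le_mul_of_nonneg_left hpD hε.le
  have hv2 : v ^ 2 ≤ K ^ 2 := sq_le_sq' (abs_le.1 hvK).1 (abs_le.1 hvK).2
  have hconst : |d₀ - θ₁ * κ₁₁ - (α / 2) * (ε * p + v ^ 2)| ≤ M₁ / ε := by
    have h1 : M₁ ≤ M₁ / ε := by
      rw [le_div_iff₀ hε]; exact mul_le_of_le_one_right hM₁0.le hε1.le
    have h2 : ε * D ≤ D := mul_le_of_le_one_left hD.le hε1.le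
    have h3 : 0 ≤ ε * p + v ^ 2 := by positivity
    refine (abs_sub _ _).trans (le_trans ?_ h1)
    rw [abs_of_nonneg (mul_nonneg (by positivity) h3)]
    have : α / 2 * (ε * p + v ^ 2) ≤ α / 2 * (D + K ^ 2) :=
      mul_le_mul_of_nonneg_left (by linarith) (by positivity)
    linarith
  have hc1 : m / 2 ≤ A + κ₂₁ * v - (β / 2) * (ε * p + v ^ 2) := by
    have := mul_le_mul_of_nonneg_left hεpD hβ.le
    linarith
  have hc2 : A + κ₂₁ * v - (β / 2) * (ε * p + v ^ 2) ≤ A + |κ₂₁| * K := by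
    have h1 : κ₂₁ * v ≤ |κ₂₁| * K := (le_abs_self _).trans (by
      rw [abs_mul]; exact mul_le_mul_of_nonneg_left hvK (abs_nonneg _))
    have h2 : 0 ≤ (β / 2) * (ε * p + v ^ 2) := by positivity
    linarith
  have t1 := mul_le_mul_of_nonneg_right hc1 hx₁
  have t2 := mul_le_mul_of_nonneg_right hc2 hx₁
  have s1 := mul_le_mul_of_nonneg_right (min_le_left (m / 2) (κ₂₂ * η)) hx₁
  have s2 := mul_le_mul_of_nonneg_right (min_le_right (m / 2) (κ₂₂ * η)) (abs_nonneg x₂)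
  have hsplit : (M₁ + 2 * B) / ε = M₁ / ε + 2 * B / ε := add_div _ _ _
  have hBε : 0 ≤ 2 * B / ε := by positivity
  have hx₁B : 0 ≤ B * x₁ := by positivity
  have hx₂A : 0 ≤ (A + |κ₂₁| * K) * |x₂| := by positivity
  obtain ⟨l1, l2⟩ := abs_le.1 hconst
  obtain ⟨u1, u2⟩ := hx₂term
  rw [hsplit]
  constructor <;> linarith
end
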